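/- For every integer d ≥ 3, the function μ ↦ ψ(p*, d, μ, 1-μ, 0) is strictly increasing on the open interval (0,1). -/

import Mathlib

noncomputable def g (p : ℝ) (d : ℕ) : ℝ :=
  1 + (1 - (1 - p) / (d : ℝ)) ^ d + ((1 - p) * (1 - 1 / (d : ℝ))) ^ d

noncomputable def pstar : ℝ := (10 - 6 * Real.sqrt 2) / 7

noncomputable def alphaAlg : ℝ := g pstar 3

noncomputable def zeta (p : ℝ) (d : ℕ) (μA μB μC : ℝ) : ℝ :=
  let T : ℝ := 1 - μA + μA * (1 - (1 - p) / (d : ℝ)) ^ d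
  let E : ℝ := 1 - μB + Real.exp (p - 1) * μB
  let Q : ℝ := (1 - p) ^ d * (1 - μA + μA * (1 - 1 / (d : ℝ)) ^ d)
  1 + T / 2 + E * T / 2 + μC * (1 - p) * E * T + (1 - μC * (1 - p)) * E * Q

noncomputable def psi (p : ℝ) (d : ℕ) (μA μB μC : ℝ) : ℝ :=
  zeta p d μA μB μC / (μA + 1.5 * μB + 3 * μC)

/-- The sequence `d ↦ (1 - s / d) ^ d` dominates its value at `3` for `d ≥ 3`. -/
theorem one_sub_div_three_pow_le {s : ℝ} (hs : s ≤ 3) {d : ℕ} (hd : 3 ≤ d) :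
    (1 - s / 3) ^ 3 ≤ (1 - s / (d : ℝ)) ^ d := by
  have hd3 : (3 : ℝ) ≤ d := by exact_mod_cast hd
  have hd0 : (0 : ℝ) < d := by linarith
  have hbase : 0 ≤ 1 - s / 3 := by linarith
  have bernoulli : (1 - s / 3) ^ (3 / (d : ℝ)) ≤ 1 - s / (d : ℝ) := by
    have h := rpow_one_add_le_one_add_mul_self (s := -(s / 3)) (p := 3 / (d : ℝ))
      (by linarith) (by positivity) ((div_le_one hd0).2 hd3)
    calc (1 - s / 3) ^ (3 / (d : ℝ)) ≤ 1 + 3 / (d : ℝ) * -(s / 3) := by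
          simpa only [← sub_eq_add_neg] using h
      _ = 1 - s / (d : ℝ) := by ring
  calc (1 - s / 3) ^ 3 = ((1 - s / 3) ^ (3 / (d : ℝ))) ^ d := by
        rw [← Real.rpow_mul_natCast hbase, div_mul_cancel₀ _ hd0.ne']
        exact_mod_cast (Real.rpow_natCast (1 - s / 3) 3).symm
    _ ≤ (1 - s / (d : ℝ)) ^ d := pow_le_pow_left₀ (Real.rpow_nonneg hbase _) bernoulli d

theorem one_sub_pstar_mem_Icc : 1 - pstar ∈ Set.Icc (0.78 : ℝ) 0.784 := by
  have h₁ : (1.414 : ℝ) ≤ √2 := Real.le_sqrt_of_sq_le (by norm_num)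
  have h₂ : √2 ≤ (1.4146 : ℝ) := Real.sqrt_le_iff.2 (by norm_num)
  unfold pstar
  constructor <;> linarith

theorem exp_pstar_sub_one_le_half : Real.exp (pstar - 1) ≤ 1 / 2 := by
  have h := one_sub_pstar_mem_Icc.1
  rw [← Real.le_log_iff_exp_le (by norm_num), one_div, Real.log_inv]
  linarith [Real.log_two_lt_d9]

theorem psi_numerator_slope_pos {d : ℕ} (hd : 3 ≤ d) :
    0 < -1 + (1 - (1 - pstar) / (d : ℝ)) ^ d * (4 - Real.exp (pstar - 1)) +
      (1 - pstar) ^ d * (-2 + (1 - 1 / (d : ℝ)) ^ d * (5 - 2 * Real.exp (pstar - 1))) := by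
  have hk := exp_pstar_sub_one_le_half
  obtain ⟨hs₁, hs₂⟩ := one_sub_pstar_mem_Icc
  have ha : (0.403 : ℝ) ≤ (1 - (1 - pstar) / (d : ℝ)) ^ d :=
    calc (0.403 : ℝ) ≤ (1 - 0.784 / 3) ^ 3 := by norm_num
      _ ≤ (1 - (1 - pstar) / 3) ^ 3 := by gcongr
      _ ≤ _ := one_sub_div_three_pow_le (by linarith) hd
  have hb : (8 / 27 : ℝ) ≤ (1 - 1 / (d : ℝ)) ^ d :=
    calc (8 / 27 : ℝ) = (1 - 1 / 3) ^ 3 := by norm_num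
      _ ≤ _ := one_sub_div_three_pow_le (by norm_num) hd
  have hq₀ : 0 ≤ (1 - pstar) ^ d := pow_nonneg (by linarith) d
  have hq : (1 - pstar) ^ d ≤ 0.482 :=
    calc (1 - pstar) ^ d ≤ (1 - pstar) ^ 3 :=
          pow_le_pow_of_le_one (by linarith) (by linarith) hd
      _ ≤ 0.784 ^ 3 := pow_le_pow_left₀ (by linarith) hs₂ 3
      _ ≤ 0.482 := by norm_num
  have haT : 0.403 * (7 / 2) ≤
      (1 - (1 - pstar) / (d : ℝ)) ^ d * (4 - Real.exp (pstar - 1)) :=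
    mul_le_mul ha (by linarith) (by norm_num) (by linarith)
  have hbQ : 8 / 27 * 4 ≤ (1 - 1 / (d : ℝ)) ^ d * (5 - 2 * Real.exp (pstar - 1)) :=
    mul_le_mul hb (by linarith) (by norm_num) (by linarith)
  have hQ := mul_le_mul_of_nonneg_left hbQ hq₀
  linarith

theorem psi_strictMono_in_mu (d : ℕ) (hd : 3 ≤ d) :
    StrictMonoOn (fun μ : ℝ => psi pstar d μ (1 - μ) 0) (Set.Ioo (0 : ℝ) 1) := by
  rintro x ⟨hx₀, hx₁⟩ y ⟨hy₀, hy₁⟩ hxy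
  have hslope := psi_numerator_slope_pos hd
  have hk := exp_pstar_sub_one_le_half
  have hs := one_sub_pstar_mem_Icc
  have hd1 : (1 : ℝ) ≤ d := by exact_mod_cast (by omega : 1 ≤ d)
  have hd0 : (0 : ℝ) < d := by linarith
  have ha : (1 - (1 - pstar) / (d : ℝ)) ^ d ≤ 1 := by
    refine pow_le_one₀ (sub_nonneg.2 ((div_le_one hd0).2 (by linarith [hs.2]))) ?_
    exact sub_le_self _ (div_nonneg (by linarith [hs.1]) hd0.le)
  have hb : (1 - 1 / (d : ℝ)) ^ d ≤ 1 :=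
    pow_le_one₀ (sub_nonneg.2 ((div_le_one hd0).2 hd1)) (sub_le_self _ (by positivity))
  have hq : 0 ≤ (1 - pstar) ^ d := pow_nonneg (by linarith [hs.1]) d
  simp only [psi, zeta]
  rw [div_lt_div_iff₀ (by linarith) (by linarith)]
  generalize (1 - (1 - pstar) / (d : ℝ)) ^ d = a at *
  generalize (1 - 1 / (d : ℝ)) ^ d = b at *
  generalize (1 - pstar) ^ d = q at *
  generalize Real.exp (pstar - 1) = k at *
  have hcurv : 0 ≤ (1 - k) * ((1 - a) / 2 + q * (1 - b)) :=
    mul_nonneg (by linarith)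
      (add_nonneg (by linarith) (mul_nonneg hq (by linarith)))
  have hxy5 : 0 ≤ 5 - (3 * (x + y) - x * y) := by nlinarith
  have hdiff := mul_pos (sub_pos.2 hxy)
    (add_pos_of_pos_of_nonneg hslope (mul_nonneg hcurv hxy5))
  linear_combination hdiff / 2
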